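/- An onto mechanism f on a discrete tree is strategyproof if and only if it is tree monotone (TMON) and almost trajectory contained (ATC, i.e., both ADR and 1-TSI). -/

import Mathlib

open Function

/-- `T = (V,E)` is a discrete tree: connected, acyclic, bounded degree. -/
def IsDiscreteTree {V : Type*} (G : SimpleGraph V) : Prop :=
  G.Connected ∧ G.IsAcyclic ∧
    ∃ D : ℕ, ∀ v : V, (G.neighborSet v).Finite ∧ (G.neighborSet v).ncard ≤ D

/-- `pathSet G u w` is the vertex set of the unique path `[u,w]`
(in a tree, exactly the vertices lying on a geodesic from `u` to `w`). -/
def pathSet {V : Type*} (G : SimpleGraph V) (u w : V) : Set V :=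
  {v | G.dist u v + G.dist v w = G.dist u w}

/-- `subtree G a b v` = `tree(a → b, v)`: the set of vertices reachable from `v`
via edges that do not lie on the path `[a,b]`. -/
def subtree {V : Type*} (G : SimpleGraph V) (a b v : V) : Set V :=
  {u | Relation.ReflTransGen
        (fun x y => G.Adj x y ∧ ¬(x ∈ pathSet G a b ∧ y ∈ pathSet G a b)) v u}

/-- Distance from a vertex to a set of vertices. -/
noncomputable def distToSet {V : Type*} (G : SimpleGraph V) (x : V) (S : Set V) : ℕ :=
  sInf (G.dist x '' S)

/-- Distance between two sets of vertices. -/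
noncomputable def setDist {V : Type*} (G : SimpleGraph V) (A B : Set V) : ℕ :=
  sInf {d : ℕ | ∃ u ∈ A, ∃ w ∈ B, G.dist u w = d}

/-- `depth(a → b, v)`: the distance of `v` from the path `[a,b]`. -/
noncomputable def depth {V : Type*} (G : SimpleGraph V) (a b v : V) : ℕ :=
  distToSet G v (pathSet G a b)

/-- A mechanism is strategyproof if no agent can get the facility strictly
closer to her true location by misreporting. -/
def Strategyproof {V : Type*} {n : ℕ} (G : SimpleGraph V)
    (f : (Fin n → V) → V) : Prop :=
  ∀ (a : Fin n → V) (i : Fin n) (b : V),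
    G.dist (a i) (f a) ≤ G.dist (a i) (f (Function.update a i b))

/-- Tree monotone (TMON): on the common part of the agent's trajectory and the
facility's trajectory, the facility moves in the same direction as the agent. -/
def TMON {V : Type*} {n : ℕ} (G : SimpleGraph V) (f : (Fin n → V) → V) : Prop :=
  ∀ (a : Fin n → V) (i : Fin n) (b : V),
    ∀ x ∈ pathSet G (a i) b ∩ pathSet G (f a) (f (Function.update a i b)),
      ∀ y ∈ pathSet G (a i) b ∩ pathSet G (f a) (f (Function.update a i b)),
        (G.dist (a i) x < G.dist (a i) y ↔ G.dist (f a) x < G.dist (f a) y)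

/-- Almost depth restricted (ADR): whenever a single agent's deviation moves
the facility within the same tree (w.r.t. the move), the old and new outcomes
are both at distance exactly 1 from the meeting point `z` of the three paths. -/
def ADR {V : Type*} {n : ℕ} (G : SimpleGraph V) (f : (Fin n → V) → V) : Prop :=
  ∀ (a : Fin n → V) (i : Fin n) (b : V),
    f a ≠ f (Function.update a i b) →
    subtree G (a i) b (f a) = subtree G (a i) b (f (Function.update a i b)) →
    ∀ z ∈ pathSet G (a i) (f a) ∩ pathSet G (a i) (f (Function.update a i b)) ∩
            pathSet G (f a) (f (Function.update a i b)),
      G.dist (f a) z = G.dist (f (Function.update a i b)) z ∧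
      G.dist (f a) z = 1

/-- 1-tree step independent (1-TSI): if the facility is at distance more than 1
from the trajectory of the deviating agent, it stays in the same tree
w.r.t. the move. -/
def OneTSI {V : Type*} {n : ℕ} (G : SimpleGraph V) (f : (Fin n → V) → V) : Prop :=
  ∀ (a : Fin n → V) (i : Fin n) (b : V),
    distToSet G (f a) (pathSet G (a i) b) > 1 →
    subtree G (a i) b (f a) = subtree G (a i) b (f (Function.update a i b))

section TreeMetric

variable {V : Type*} {G : SimpleGraph V}

/-- The vertex `p` is the projection of `x` onto the path `[a,b]`. -/
structure IsProj (G : SimpleGraph V) (a b x p : V) : Prop where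
  mem : G.dist a p + G.dist p b = G.dist a b
  left : G.dist a p + G.dist p x = G.dist a x
  right : G.dist b p + G.dist p x = G.dist b x

lemma IsProj.symm {a b x p : V} (h : IsProj G a b x p) : IsProj G b a x p where
  mem := by
    have := h.mem
    grind [SimpleGraph.dist_comm]
  left := h.right
  right := h.left

lemma exists_adj_closer (hT : G.IsTree) {u w : V} (h : u ≠ w) :
    ∃ u', G.Adj u u' ∧ G.dist u w = G.dist u' w + 1 := by
  obtain ⟨p, hp⟩ := hT.connected.exists_walk_length_eq_dist u w
  cases p with
  | nil => exact absurd rfl h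
  | @cons _ u' _ hadj q =>
    refine ⟨u', hadj, ?_⟩
    have h1 := G.dist_le q
    have h2 := hT.connected.dist_triangle (u := u) (v := u') (w := w)
    have h3 := SimpleGraph.dist_eq_one_iff_adj.2 hadj
    simp only [SimpleGraph.Walk.length_cons] at hp
    omega

lemma adj_closer_unique (hT : G.IsTree) {u u₁ u₂ w : V} (h₁ : G.Adj u u₁) (h₂ : G.Adj u u₂)
    (hd₁ : G.dist u w = G.dist u₁ w + 1) (hd₂ : G.dist u w = G.dist u₂ w + 1) : u₁ = u₂ := by
  obtain ⟨p, hp⟩ := hT.connected.exists_walk_length_eq_dist u₁ w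
  obtain ⟨q, hq⟩ := hT.connected.exists_walk_length_eq_dist u₂ w
  have hp' : (SimpleGraph.Walk.cons h₁ p).IsPath :=
    SimpleGraph.Walk.isPath_of_length_eq_dist _ (by simp; omega)
  have hq' : (SimpleGraph.Walk.cons h₂ q).IsPath :=
    SimpleGraph.Walk.isPath_of_length_eq_dist _ (by simp; omega)
  have := (hT.isAcyclic.subsingleton_path u w).elim ⟨_, hp'⟩ ⟨_, hq'⟩
  simp only [Subtype.mk.injEq, SimpleGraph.Walk.cons.injEq] at this
  exact this.1

lemma dist_adj_cases (hT : G.IsTree) {m m' : V} (h : G.Adj m m') (v : V) :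
    G.dist m v = G.dist m' v + 1 ∨ G.dist m' v = G.dist m v + 1 := by
  have := hT.dist_eq_dist_add_one_of_adj v h
  simpa only [G.dist_comm (u := v)] using this

/-- A shortest path between the two sides of an edge crosses that edge. -/
lemma dist_across_edge (hT : G.IsTree) {m m' v w : V} (h : G.Adj m m')
    (hv : G.dist m' v = G.dist m v + 1) (hw : G.dist m w = G.dist m' w + 1) :
    G.dist v w = G.dist m v + 1 + G.dist m' w := by
  induction hk : G.dist m v generalizing v with
  | zero =>
    obtain rfl := hT.connected.dist_eq_zero_iff.1 hk
    omega
  | succ k ih =>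
    have hne : v ≠ m := by rintro rfl; simp at hk
    obtain ⟨v₁, hadj, hd⟩ := exists_adj_closer hT hne
    rw [G.dist_comm (u := v), G.dist_comm (u := v₁)] at hd
    have hv₁ : G.dist m' v₁ = G.dist m v₁ + 1 := by
      have := dist_adj_cases hT hadj m'
      have := dist_adj_cases hT h v₁
      grind [SimpleGraph.dist_comm]
    have hw₁ := ih hv₁ (by omega)
    rcases dist_adj_cases hT hadj w with hc | hc
    · omega
    · exfalso
      by_cases hm : v₁ = m
      · subst hm
        have := adj_closer_unique hT hadj.symm h hc hw
        subst this
        simp at hv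
      · obtain ⟨v₂, hadj₂, hd₂⟩ := exists_adj_closer hT hm
        have hd₂' : G.dist v₁ w = G.dist v₂ w + 1 := by
          have t1 := hT.connected.dist_triangle (u := v₂) (v := m) (w := w)
          rcases dist_adj_cases hT hadj₂ w with h1 | h1
          · exact h1
          · grind [SimpleGraph.dist_comm]
        have := adj_closer_unique hT hadj.symm hadj₂ hc hd₂'
        subst this
        grind [SimpleGraph.dist_comm]

lemma dist_of_mem_path_of_le (hT : G.IsTree) {a b p q : V}
    (hp : G.dist a p + G.dist p b = G.dist a b) (hq : G.dist a q + G.dist q b = G.dist a b)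
    (hle : G.dist a p ≤ G.dist a q) : G.dist a q = G.dist a p + G.dist p q := by
  induction hk : G.dist a p generalizing a with
  | zero =>
    obtain rfl := hT.connected.dist_eq_zero_iff.1 hk
    omega
  | succ k ih =>
    have hap : a ≠ p := by rintro rfl; simp at hk
    have haq : a ≠ q := by rintro rfl; rw [SimpleGraph.dist_self] at hle; omega
    obtain ⟨a₁, h₁, hd₁⟩ := exists_adj_closer hT hap
    obtain ⟨a₂, h₂, hd₂⟩ := exists_adj_closer hT haq
    have e₁ : G.dist a b = G.dist a₁ b + 1 := by
      have := hT.connected.dist_triangle (u := a₁) (v := p) (w := b)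
      have := dist_adj_cases hT h₁ b
      omega
    have e₂ : G.dist a b = G.dist a₂ b + 1 := by
      have := hT.connected.dist_triangle (u := a₂) (v := q) (w := b)
      have := dist_adj_cases hT h₂ b
      omega
    obtain rfl := adj_closer_unique hT h₁ h₂ e₁ e₂
    have := ih (a := a₁) (by omega) (by omega) (by omega) (by omega)
    omega

lemma exists_isProj (hT : G.IsTree) (a b x : V) : ∃ p, IsProj G a b x p := by
  induction hk : G.dist a b generalizing a with
  | zero =>
    obtain rfl := hT.connected.dist_eq_zero_iff.1 hk
    exact ⟨a, by simp, by simp, by simp⟩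
  | succ k ih =>
    have hab : a ≠ b := by rintro rfl; simp at hk
    obtain ⟨a', h, hd⟩ := exists_adj_closer hT hab
    rcases dist_adj_cases hT h x with hx | hx
    · obtain ⟨p, hp⟩ := ih a' (by omega)
      have h2 := hT.connected.dist_triangle (u := a) (v := p) (w := x)
      have h3 := hT.connected.dist_triangle (u := a) (v := a') (w := p)
      have h4 := SimpleGraph.dist_eq_one_iff_adj.2 h
      have := hp.mem
      have := hp.left
      exact ⟨p, by omega, by omega, hp.right⟩
    · refine ⟨a, by simp, by simp, ?_⟩
      have := dist_across_edge hT h hx hd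
      grind [SimpleGraph.dist_comm]

/-- A vertex of the path `[a,b]` is reached from `x` through the projection of `x`. -/
lemma IsProj.dist_of_mem (hT : G.IsTree) {a b x p u : V} (h : IsProj G a b x p)
    (hu : G.dist a u + G.dist u b = G.dist a b) : G.dist x u = G.dist x p + G.dist p u := by
  wlog hle : G.dist a p ≤ G.dist a u generalizing a b
  · have hmem := h.mem
    refine this h.symm ?_ ?_ <;> grind [SimpleGraph.dist_comm]
  have h1 := dist_of_mem_path_of_le hT h.mem hu hle
  have h2 := h.right
  have h3 := h.mem
  have h4 := hT.connected.dist_triangle (u := b) (v := u) (w := x)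
  have h5 := hT.connected.dist_triangle (u := x) (v := p) (w := u)
  grind [SimpleGraph.dist_comm]

lemma IsProj.unique (hT : G.IsTree) {a b x p q : V} (hp : IsProj G a b x p)
    (hq : IsProj G a b x q) : p = q := by
  have h1 := hp.dist_of_mem hT hq.mem
  have h2 := hq.dist_of_mem hT hp.mem
  exact hT.connected.dist_eq_zero_iff.1 (by omega)

lemma IsProj.dist_of_ne (hT : G.IsTree) {a b x y p q : V} (hp : IsProj G a b x p)
    (hq : IsProj G a b y q) (hpq : p ≠ q) :
    G.dist x y = G.dist x p + G.dist p q + G.dist q y := by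
  wlog hle : G.dist a p ≤ G.dist a q generalizing a b
  · have hpm := hp.mem
    have hqm := hq.mem
    refine this hp.symm hq.symm ?_
    grind [SimpleGraph.dist_comm]
  obtain ⟨m, hadj, hd⟩ := exists_adj_closer hT hpq
  have h1 := dist_of_mem_path_of_le hT hp.mem hq.mem hle
  have a1 := hp.mem
  have a3 := hp.right
  have b1 := hq.mem
  have b2 := hq.left
  have c1 := G.dist_comm (u := p) (v := b)
  have c3 := G.dist_comm (u := m) (v := b)
  have c4 := G.dist_comm (u := p) (v := x)
  have hx : G.dist m x = G.dist p x + 1 := by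
    have := hT.connected.dist_triangle (u := m) (v := q) (w := b)
    have := hT.connected.dist_triangle (u := b) (v := m) (w := x)
    have := dist_adj_cases hT hadj x
    omega
  have hy : G.dist p y = G.dist m y + 1 := by
    have := hT.connected.dist_triangle (u := m) (v := q) (w := y)
    have := hT.connected.dist_triangle (u := a) (v := p) (w := y)
    have := dist_adj_cases hT hadj y
    omega
  have := dist_across_edge hT hadj hx hy
  have := hT.connected.dist_triangle (u := a) (v := p) (w := y)
  have := hT.connected.dist_triangle (u := m) (v := q) (w := y)
  omega

lemma IsProj.distToSet_eq (hT : G.IsTree) {a b x p : V} (hp : IsProj G a b x p) :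
    distToSet G x (pathSet G a b) = G.dist x p := by
  refine le_antisymm (Nat.sInf_le ⟨p, hp.mem, rfl⟩) (le_csInf ⟨_, p, hp.mem, rfl⟩ ?_)
  rintro _ ⟨u, hu, rfl⟩
  have := hp.dist_of_mem hT hu
  omega

lemma IsProj.mem_subtree (hT : G.IsTree) {a b x p : V} (hp : IsProj G a b x p) :
    p ∈ subtree G a b x := by
  induction hk : G.dist x p generalizing x with
  | zero =>
    obtain rfl := hT.connected.dist_eq_zero_iff.1 hk
    exact .refl
  | succ k ih =>
    have hxp : x ≠ p := by rintro rfl; simp at hk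
    obtain ⟨x', hadj, hd⟩ := exists_adj_closer hT hxp
    have hx' : IsProj G a b x' p := by
      refine ⟨hp.mem, ?_, ?_⟩
      · have := hp.left
        have := dist_adj_cases hT hadj a
        have := hT.connected.dist_triangle (u := a) (v := p) (w := x')
        grind [SimpleGraph.dist_comm]
      · have := hp.right
        have := dist_adj_cases hT hadj b
        have := hT.connected.dist_triangle (u := b) (v := p) (w := x')
        grind [SimpleGraph.dist_comm]
    refine Relation.ReflTransGen.head ⟨hadj, fun h => ?_⟩ (ih hx' (by omega))
    have := hp.dist_of_mem hT h.1
    simp at this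
    omega

lemma subtree_eq_of_mem {a b x y : V} (h : y ∈ subtree G a b x) :
    subtree G a b x = subtree G a b y := by
  have hs : Std.Symm
      (fun x y => G.Adj x y ∧ ¬(x ∈ pathSet G a b ∧ y ∈ pathSet G a b)) :=
    ⟨fun _ _ h => ⟨h.1.symm, fun h' => h.2 h'.symm⟩⟩
  have h' : x ∈ subtree G a b y := Std.Symm.symm (self := inferInstance) _ _ h
  ext z
  exact ⟨fun hz => h'.trans hz, fun hz => h.trans hz⟩

lemma IsProj.of_mem_subtree (hT : G.IsTree) {a b x y p : V} (hp : IsProj G a b x p)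
    (h : y ∈ subtree G a b x) : IsProj G a b y p := by
  induction h with
  | refl => exact hp
  | @tail y z _ hyz ih =>
    obtain ⟨q, hq⟩ := exists_isProj hT a b z
    by_cases hpq : p = q
    · rwa [hpq]
    · have h1 := ih.dist_of_ne hT hq hpq
      have h2 := SimpleGraph.dist_eq_one_iff_adj.2 hyz.1
      have h3 := hT.connected.pos_dist_of_ne hpq
      obtain rfl : y = p := hT.connected.dist_eq_zero_iff.1 (by omega)
      obtain rfl : q = z := hT.connected.dist_eq_zero_iff.1 (by omega)
      exact absurd ⟨ih.mem, hq.mem⟩ hyz.2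

lemma subtree_eq_iff (hT : G.IsTree) {a b x y p q : V} (hp : IsProj G a b x p)
    (hq : IsProj G a b y q) : subtree G a b x = subtree G a b y ↔ p = q := by
  constructor
  · intro h
    have hy : y ∈ subtree G a b x := h ▸ Relation.ReflTransGen.refl
    exact (hp.of_mem_subtree hT hy).unique hT hq
  · rintro rfl
    rw [subtree_eq_of_mem (hp.mem_subtree hT), subtree_eq_of_mem (hq.mem_subtree hT)]

end TreeMetric

section SingleAgent

variable {V : Type*} {G : SimpleGraph V}

/-- Across an edge, the single-agent outcome map `g` does not jump from one side to the other
when the outcome is far from the edge. -/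
def NoLongJump (G : SimpleGraph V) (g : V → V) : Prop :=
  ∀ ⦃m m' : V⦄, G.Adj m m' → G.dist m' (g m) = G.dist m (g m) + 1 →
    G.dist m (g m') = G.dist m' (g m') + 1 → G.dist m (g m) ≤ 1

/-- Two equally distant outcomes at distance at least two from `z`, one of which is selected at
`z`, cannot lie on opposite sides of `z`. -/
lemma NoLongJump.dist_ne (hT : G.IsTree) {g : V → V}
    (hg : ∀ u v, G.dist u (g u) ≤ G.dist u (g v)) (hL : NoLongJump G g) {z v : V}
    (hz : G.dist z (g v) = G.dist z (g z)) (h2 : 2 ≤ G.dist z (g z)) :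
    G.dist (g v) (g z) ≠ G.dist z (g v) + G.dist z (g z) := by
  intro h
  have hne : z ≠ g v := by intro h; rw [← h] at hz; simp at hz; omega
  obtain ⟨r, hadj, hd⟩ := exists_adj_closer hT hne
  have h1 : G.dist r (g z) = G.dist z (g z) + 1 := by
    rcases dist_adj_cases hT hadj (g z) with h3 | h3
    · have := hT.connected.dist_triangle (u := g v) (v := r) (w := g z)
      have := G.dist_comm (u := g v) (v := r)
      omega
    · exact h3
  have h3 := hg r v
  have h4 := hg z r
  have h5 : G.dist z (g r) = G.dist r (g r) + 1 := by
    rcases dist_adj_cases hT hadj (g r) with h5 | h5 <;> omega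
  have := hL hadj h1 h5
  omega

lemma dist_eq_of_depth (hT : G.IsTree) {g : V → V}
    (hg : ∀ u v, G.dist u (g u) ≤ G.dist u (g v)) (hL : NoLongJump G g) {a b p : V}
    (hp : IsProj G a b (g a) p) (h2 : 2 ≤ G.dist p (g a)) :
    G.dist b (g b) = G.dist b (g a) := by
  have hbase : G.dist p (g p) = G.dist p (g a) ∧
      G.dist b (g p) = G.dist p b + G.dist p (g p) := by
    have h0 : G.dist p (g p) = G.dist p (g a) := by
      have := hg p a
      have := hg a p
      have := hp.left
      have := hT.connected.dist_triangle (u := a) (v := p) (w := g p)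
      omega
    refine ⟨h0, ?_⟩
    by_cases hpb : p = b
    · subst hpb; simp
    obtain ⟨m, hadj, hd⟩ := exists_adj_closer hT hpb
    have c1 := G.dist_comm (u := p) (v := b)
    have c2 := G.dist_comm (u := m) (v := b)
    have hx : G.dist m (g a) = G.dist p (g a) + 1 := by
      have := hT.connected.dist_triangle (u := b) (v := m) (w := g a)
      have := dist_adj_cases hT hadj (g a)
      have := hp.right
      omega
    rcases dist_adj_cases hT hadj (g p) with h3 | h3
    · have := dist_across_edge hT hadj hx h3
      exact absurd (by omega) (hL.dist_ne hT hg h0.symm (by omega))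
    · have := dist_across_edge hT hadj h3 hd
      have := G.dist_comm (u := g p) (v := b)
      omega
  have key : ∀ k m, G.dist p m = k → G.dist p m + G.dist m b = G.dist p b →
      G.dist m (g m) = k + G.dist p (g a) ∧ G.dist b (g m) = G.dist m b + G.dist m (g m) := by
    intro k
    induction k with
    | zero =>
      intro m hm _
      obtain rfl := hT.connected.dist_eq_zero_iff.1 hm
      exact ⟨by omega, hbase.2⟩
    | succ k ih =>
      intro m' hm' hmem
      have hne : m' ≠ p := by rintro rfl; simp at hm'
      obtain ⟨m, hadj', hd⟩ := exists_adj_closer hT hne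
      have hadj := hadj'.symm
      have c1 := G.dist_comm (u := p) (v := m)
      have c2 := G.dist_comm (u := p) (v := m')
      have c3 := G.dist_comm (u := m') (v := b)
      have c4 := G.dist_comm (u := b) (v := g m')
      have hmb : G.dist m b = G.dist m' b + 1 := by
        have := hT.connected.dist_triangle (u := p) (v := m) (w := b)
        have := dist_adj_cases hT hadj b
        omega
      obtain ⟨e1, e2⟩ := ih m (by omega) (by omega)
      have h3 : G.dist m' (g m) = G.dist m (g m) + 1 := by
        have := hT.connected.dist_triangle (u := b) (v := m') (w := g m)
        have := dist_adj_cases hT hadj (g m)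
        omega
      have h4 : G.dist m' (g m') = G.dist m (g m') + 1 := by
        rcases dist_adj_cases hT hadj (g m') with h5 | h5
        · have := hL hadj h3 h5
          omega
        · exact h5
      have := hg m m'
      have := hg m' m
      have := dist_across_edge hT hadj h4 hmb
      omega
  have c := G.dist_comm (u := p) (v := b)
  have := (key _ b rfl (by simp)).1
  have := hp.right
  omega

end SingleAgent

section Mechanism

variable {V ι : Type*} [DecidableEq ι] {G : SimpleGraph V} {f : (ι → V) → V}

/-- A property stable under moving any agent of `s` to `w` holds after moving all of them. -/
lemma piecewise_const_induction {P : (ι → V) → Prop} {c : ι → V} (w : V) (s : Finset ι)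
    (h0 : P c) (hs : ∀ c' j, j ∈ s → c' j = c j → P c' → P (update c' j w)) :
    P (s.piecewise (fun _ => w) c) := by
  induction s using Finset.induction_on with
  | empty => simpa using h0
  | insert j s hj ih =>
    rw [Finset.piecewise_insert]
    refine hs _ j (Finset.mem_insert_self _ _) (Finset.piecewise_eq_of_notMem _ _ _ hj) ?_
    exact ih fun c' k hk => hs c' k (Finset.mem_insert_of_mem hk)

lemma dist_update_le
    (hsp : ∀ (a : ι → V) (i : ι) (b : V), G.dist (a i) (f a) ≤ G.dist (a i) (f (update a i b)))
    (c : ι → V) (j : ι) (w : V) : G.dist w (f (update c j w)) ≤ G.dist w (f c) := by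
  simpa using hsp (update c j w) j (c j)

lemma apply_const_of_surjective [Fintype ι] (hG : G.Connected)
    (hsp : ∀ (a : ι → V) (i : ι) (b : V), G.dist (a i) (f a) ≤ G.dist (a i) (f (update a i b)))
    (hf : Surjective f) (x : V) : f (fun _ => x) = x := by
  obtain ⟨c, hc⟩ := hf x
  have := piecewise_const_induction (P := fun c => f c = x) x Finset.univ hc
    fun c' j _ _ h => by
      have := dist_update_le hsp c' j x
      rw [h, SimpleGraph.dist_self, Nat.le_zero, hG.dist_eq_zero_iff] at this
      exact this.symm
  simpa using this

lemma le_one_of_jump [Fintype ι] (hT : G.IsTree)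
    (hsp : ∀ (a : ι → V) (i : ι) (b : V), G.dist (a i) (f a) ≤ G.dist (a i) (f (update a i b)))
    (hf : Surjective f) {c : ι → V} {i : ι} {m m' : V} (h : G.Adj m m')
    (hm : G.dist m' (f (update c i m)) = G.dist m (f (update c i m)) + 1)
    (hle : G.dist m' (f (update c i m')) ≤ G.dist m (f (update c i m))) :
    G.dist m (f (update c i m)) ≤ 1 := by
  classical
  by_contra! h2
  have hmm := SimpleGraph.dist_eq_one_iff_adj.2 h
  set k := G.dist m (f (update c i m)) with hk
  -- first gather at `m'` the other agents on the side of `m'`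
  have stage := piecewise_const_induction (c := c)
    (P := fun c' => G.dist m' (f (update c' i m)) = k + 1 ∧ G.dist m (f (update c' i m)) = k ∧
      G.dist m' (f (update c' i m')) ≤ k) m'
    (Finset.univ.filter fun j => j ≠ i ∧ G.dist m (c j) = G.dist m' (c j) + 1)
    ⟨hm, rfl, hle⟩ ?_
  · set d := Finset.piecewise (Finset.univ.filter fun j => j ≠ i ∧
      G.dist m (c j) = G.dist m' (c j) + 1) (fun _ => m') c with hd
    obtain ⟨-, s2, s3⟩ := stage
    have s4 : k ≤ G.dist m (f (update d i m')) := by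
      simpa [s2] using hsp (update d i m) i m'
    have s5 : G.dist m (f (update d i m')) = G.dist m' (f (update d i m')) + 1 := by
      have := dist_adj_cases hT h (f (update d i m'))
      omega
    have hloc : ∀ j, update d i m' j = m' ∨
        G.dist m' (update d i m' j) = G.dist m (update d i m' j) + 1 := by
      intro j
      by_cases hji : j = i
      · subst hji; simp
      rw [update_of_ne hji]
      by_cases hj : G.dist m (c j) = G.dist m' (c j) + 1
      · left; simp [hd, hji, hj]
      · right
        have : d j = c j := by simp [hd, hj]
        rw [this]
        exact (dist_adj_cases hT h (c j)).resolve_left hj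
    -- then gather at `m'` all the remaining agents
    have all := piecewise_const_induction (c := update d i m')
      (P := fun c' => G.dist m (f c') = G.dist m' (f c') + 1 ∧ 1 ≤ G.dist m' (f c')) m'
      Finset.univ ⟨s5, by omega⟩ fun c' j _ hj ⟨e1, e2⟩ => by
        rcases hloc j with hl | hl
        · rw [show update c' j m' = c' by rw [← hl, ← hj, update_eq_self]]
          exact ⟨e1, e2⟩
        · rw [← hj] at hl
          have t1 := hsp c' j m'
          have t2 := dist_update_le hsp c' j m'
          have t3 := dist_across_edge hT h hl e1
          have t4 := hT.connected.dist_triangle (u := c' j) (v := m)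
            (w := f (update c' j m'))
          have t5 := G.dist_comm (u := c' j) (v := m)
          have t6 := dist_adj_cases hT h (f (update c' j m'))
          omega
    have := apply_const_of_surjective hT.connected hsp hf m'
    simp [this] at all
  · rintro c' j hj hcj ⟨e1, e2, e3⟩
    simp only [Finset.mem_filter, Finset.mem_univ, true_and] at hj
    obtain ⟨hji, hj⟩ := hj
    rw [← hcj] at hj
    have f1 : update (update c' j m') i m = update (update c' i m) j m' :=
      update_comm hji _ _ _
    have f2 : update (update c' j m') i m' = update (update c' i m') j m' :=
      update_comm hji _ _ _
    have t0 : G.dist m (f (update (update c' j m') i m)) ≤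
        G.dist m (f (update (update c' j m') i m')) := by
      simpa using hsp (update (update c' j m') i m) i m'
    rw [f1, f2] at *
    have t1 := hsp (update c' i m) j m'
    rw [update_of_ne hji] at t1
    have t2 := dist_update_le hsp (update c' i m) j m'
    have t3 := dist_update_le hsp (update c' i m') j m'
    have t4 := dist_across_edge hT h (by omega) hj (v := f (update c' i m))
    have t5 := G.dist_comm (u := f (update c' i m)) (v := c' j)
    have t6 := hT.connected.dist_triangle (u := c' j) (v := m')
      (w := f (update (update c' i m) j m'))
    have t7 := G.dist_comm (u := c' j) (v := m')
    have t8 := dist_adj_cases hT h (f (update (update c' i m) j m'))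
    have t9 := hT.connected.dist_triangle (u := m) (v := m')
      (w := f (update (update c' i m') j m'))
    have t10 : G.dist m' (f (update (update c' i m) j m')) =
        G.dist m (f (update (update c' i m) j m')) + 1 := by omega
    exact ⟨by omega, by omega, by omega⟩

lemma noLongJump [Fintype ι] (hT : G.IsTree)
    (hsp : ∀ (a : ι → V) (i : ι) (b : V), G.dist (a i) (f a) ≤ G.dist (a i) (f (update a i b)))
    (hf : Surjective f) (c : ι → V) (i : ι) : NoLongJump G fun v => f (update c i v) := by
  intro m m' h hm hm'
  rcases le_total (G.dist m' (f (update c i m'))) (G.dist m (f (update c i m))) with hle | hle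
  · exact le_one_of_jump hT hsp hf h hm hle
  · exact hle.trans (le_one_of_jump hT hsp hf h.symm hm' hle)

end Mechanism

section Characterization

variable {V : Type*} {n : ℕ} {G : SimpleGraph V} {f : (Fin n → V) → V}

lemma Strategyproof.update_le (hsp : Strategyproof G f) (a : Fin n → V) (i : Fin n) (u v : V) :
    G.dist u (f (update a i u)) ≤ G.dist u (f (update a i v)) := by
  simpa using hsp (update a i u) i v

lemma Strategyproof.tmon (hT : G.IsTree) (hsp : Strategyproof G f) : TMON G f := by
  intro a i b u ⟨hu, hu'⟩ v ⟨hv, hv'⟩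
  simp only [pathSet, Set.mem_ofPred_eq] at hu hu' hv hv'
  obtain ⟨p, hp⟩ := exists_isProj hT (a i) b (f a)
  obtain ⟨q, hq⟩ := exists_isProj hT (a i) b (f (update a i b))
  have s1 := hsp a i b
  have s2 := dist_update_le hsp a i b
  have u1 := hp.dist_of_mem hT hu
  have u2 := hq.dist_of_mem hT hu
  have v1 := hp.dist_of_mem hT hv
  have v2 := hq.dist_of_mem hT hv
  have cu := G.dist_comm (u := u) (v := f (update a i b))
  have cv := G.dist_comm (u := v) (v := f (update a i b))
  have cq := G.dist_comm (u := q) (v := f (update a i b))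
  by_cases hpq : p = q
  · subst hpq
    have t := hT.connected.dist_triangle (u := f a) (v := p) (w := f (update a i b))
    obtain rfl : p = u := hT.connected.dist_eq_zero_iff.1 (by omega)
    obtain rfl : p = v := hT.connected.dist_eq_zero_iff.1 (by omega)
    simp
  · have hd := hp.dist_of_ne hT hq hpq
    have p1 := hp.left
    have p2 := hp.right
    have p3 := hp.mem
    have q1 := hq.left
    have q2 := hq.right
    have q3 := hq.mem
    have c1 := G.dist_comm (u := b) (v := p)
    have c2 := G.dist_comm (u := b) (v := q)
    have c3 := G.dist_comm (u := q) (v := u)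
    have c4 := G.dist_comm (u := q) (v := v)
    have e := dist_of_mem_path_of_le hT p3 q3 (by omega)
    have t1 := hT.connected.dist_triangle (u := a i) (v := p) (w := u)
    have t2 := hT.connected.dist_triangle (u := a i) (v := u) (w := q)
    have t3 := hT.connected.dist_triangle (u := a i) (v := p) (w := v)
    have t4 := hT.connected.dist_triangle (u := a i) (v := v) (w := q)
    omega

lemma Strategyproof.adr (hT : G.IsTree) (hsp : Strategyproof G f) (hf : Surjective f) :
    ADR G f := by
  rintro a i b hne hsub z ⟨⟨z1, z2⟩, z3⟩
  simp only [pathSet, Set.mem_ofPred_eq] at z1 z2 z3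
  obtain ⟨p, hp⟩ := exists_isProj hT (a i) b (f a)
  obtain ⟨q, hq⟩ := exists_isProj hT (a i) b (f (update a i b))
  obtain rfl := (subtree_eq_iff hT hp hq).1 hsub
  have s1 := hsp a i b
  have s2 := dist_update_le hsp a i b
  have p1 := hp.left
  have p2 := hp.right
  have q1 := hq.left
  have q2 := hq.right
  have cz := G.dist_comm (u := z) (v := f a)
  have cz' := G.dist_comm (u := z) (v := f (update a i b))
  have hpos := hT.connected.pos_dist_of_ne hne
  have heq : G.dist (f a) z = G.dist (f (update a i b)) z := by omega
  refine ⟨heq, ?_⟩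
  by_contra hk
  have r1 := hsp a i z
  have r2 := hsp.update_le a i z b
  have r3 := hT.connected.dist_triangle (u := a i) (v := z) (w := f (update a i z))
  have hg := hsp.update_le a i
  have hL := noLongJump hT hsp hf a i
  -- if `f a` and `g z` are not on opposite sides of `z`, they share a neighbor of `z`
  have hclose : ∀ v, G.dist z (f (update a i v)) = G.dist z (f (update a i z)) →
      ∃ r, G.Adj z r ∧ G.dist z (f (update a i v)) = G.dist r (f (update a i v)) + 1 ∧
        G.dist z (f (update a i z)) = G.dist r (f (update a i z)) + 1 := by
    intro v hv
    have hne : z ≠ f (update a i v) := by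
      intro h
      rw [← h, SimpleGraph.dist_self] at hv
      omega
    obtain ⟨r, hadj, hd⟩ := exists_adj_closer hT hne
    refine ⟨r, hadj, hd, (dist_adj_cases hT hadj _).resolve_right fun h => ?_⟩
    have := dist_across_edge hT hadj h hd
    have := G.dist_comm (u := f (update a i v)) (v := f (update a i z))
    exact hL.dist_ne hT hg hv (by omega) (by omega)
  obtain ⟨r, hr, hr1, hr2⟩ := hclose (a i) (by simp only [update_eq_self]; omega)
  obtain ⟨r', hr', hr1', hr2'⟩ := hclose b (by omega)
  obtain rfl := adj_closer_unique hT hr hr' hr2 hr2'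
  simp only [update_eq_self] at hr1
  have := hT.connected.dist_triangle (u := f a) (v := r) (w := f (update a i b))
  have := G.dist_comm (u := f a) (v := r)
  omega

lemma Strategyproof.oneTSI (hT : G.IsTree) (hsp : Strategyproof G f) (hf : Surjective f) :
    OneTSI G f := by
  intro a i b h
  obtain ⟨p, hp⟩ := exists_isProj hT (a i) b (f a)
  obtain ⟨q, hq⟩ := exists_isProj hT (a i) b (f (update a i b))
  rw [hp.distToSet_eq hT] at h
  rw [subtree_eq_iff hT hp hq]
  have s1 := hsp a i b
  have p1 := hp.left
  have p2 := hp.right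
  have p3 := hp.mem
  have q1 := hq.left
  have q2 := hq.right
  have q3 := hq.mem
  have c1 := G.dist_comm (u := b) (v := p)
  have c2 := G.dist_comm (u := b) (v := q)
  have c3 := G.dist_comm (u := p) (v := f a)
  have hg := hsp.update_le a i
  have hL := noLongJump hT hsp hf a i
  have e1 := dist_eq_of_depth hT hg hL (a := a i) (b := b) (p := p)
    (by simpa using hp) (by simp; omega)
  simp only [update_eq_self] at e1
  have e2 := dist_eq_of_depth hT hg hL (a := b) (b := a i) (p := q) hq.symm
  simp only [update_eq_self] at e2
  rcases le_total (G.dist (a i) p) (G.dist (a i) q) with hle | hle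
  · have e := dist_of_mem_path_of_le hT p3 q3 hle
    exact hT.connected.dist_eq_zero_iff.1 (by omega)
  · have e := dist_of_mem_path_of_le hT q3 p3 hle
    refine (hT.connected.dist_eq_zero_iff.1 ?_).symm
    omega

lemma strategyproof_of_tmon_of_adr_of_oneTSI (hT : G.IsTree) (hM : TMON G f) (hA : ADR G f)
    (hS : OneTSI G f) : Strategyproof G f := by
  intro a i b
  obtain ⟨p, hp⟩ := exists_isProj hT (a i) b (f a)
  obtain ⟨q, hq⟩ := exists_isProj hT (a i) b (f (update a i b))
  by_cases hpq : p = q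
  · by_cases hne : f a = f (update a i b)
    · rw [← hne]
    obtain ⟨z, hz⟩ := exists_isProj hT (f a) (f (update a i b)) (a i)
    have z1 := hz.left
    have z2 := hz.right
    have c1 := G.dist_comm (u := z) (v := f a)
    have c2 := G.dist_comm (u := z) (v := f (update a i b))
    have c3 := G.dist_comm (u := a i) (v := f a)
    have c4 := G.dist_comm (u := a i) (v := f (update a i b))
    have c5 := G.dist_comm (u := a i) (v := z)
    have := (hA a i b hne ((subtree_eq_iff hT hp hq).2 hpq) z
      ⟨⟨show _ + _ = _ by omega, show _ + _ = _ by omega⟩, hz.mem⟩).1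
    omega
  · have hd := hp.dist_of_ne hT hq hpq
    have c := G.dist_comm (u := f a) (v := p)
    have hpos := hT.connected.pos_dist_of_ne hpq
    have t1 := hT.connected.dist_triangle (u := f a) (v := p) (w := q)
    have t2 := hT.connected.dist_triangle (u := f a) (v := q) (w := f (update a i b))
    have t3 := hT.connected.dist_triangle (u := p) (v := q) (w := f (update a i b))
    have t4 := hT.connected.dist_triangle (u := f a) (v := p) (w := f (update a i b))
    have hlt := (hM a i b p ⟨hp.mem, show _ + _ = _ by omega⟩ q
      ⟨hq.mem, show _ + _ = _ by omega⟩).2 (by omega)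
    have h1 : G.dist (f a) p ≤ 1 := by
      by_contra! h
      exact hpq ((subtree_eq_iff hT hp hq).1 (hS a i b (by rwa [hp.distToSet_eq hT])))
    have := hp.left
    have := hq.left
    omega

end Characterization

/-- an onto mechanism on a discrete tree is strategyproof if and
only if it is TMON and ATC (= ADR and 1-TSI). -/
theorem onto_sp_iff_tmon_atc {V : Type*} {n : ℕ} (G : SimpleGraph V)
    (hT : IsDiscreteTree G) (f : (Fin n → V) → V)
    (hOnto : Function.Surjective f) :
    Strategyproof G f ↔ (TMON G f ∧ ADR G f ∧ OneTSI G f) := by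
  have hG : G.IsTree := ⟨hT.1, hT.2.1⟩
  exact ⟨fun h => ⟨h.tmon hG, h.adr hG hOnto, h.oneTSI hG hOnto⟩,
    fun ⟨hM, hA, hS⟩ => strategyproof_of_tmon_of_adr_of_oneTSI hG hM hA hS⟩
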